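/- arXiv:1407.2436 — 2 statements merged into one kernel-verified Lean document; each statement's English description precedes it below -/
import Mathlib

section
/- For λ > 0 there exists C > 0 such that |∫₀^∞ D_{λ,x} P_t^λ(x,y) dy| ≤ C/(x+t) for all x, t ∈ (0,∞). That is, |t D_{λ,x} P_t^λ(1)(x)| ≤ C t/(x+t). -/
open MeasureTheory Real Set

/-- The Bessel–Poisson kernel `P_t^λ(x,y)`. -/
noncomputable def besselPoissonKernel (l x y t : ℝ) : ℝ :=
  2 * l * (x * y) ^ l * t / π *
    ∫ θ in (0:ℝ)..π, Real.sin θ ^ (2 * l - 1) /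
      ((x - y) ^ 2 + t ^ 2 + 2 * x * y * (1 - Real.cos θ)) ^ (l + 1)

/-- `D_{λ,x} P_t^λ(x,y)`, where `D_λ = x^λ ∂_x x^{-λ}`. -/
noncomputable def DxBesselPoissonKernel (l x y t : ℝ) : ℝ :=
  -(4 * l * (l + 1) / π) * (x * y) ^ l * t *
    ∫ θ in (0:ℝ)..π, Real.sin θ ^ (2 * l - 1) * (x - y * Real.cos θ) /
      ((x - y) ^ 2 + t ^ 2 + 2 * x * y * (1 - Real.cos θ)) ^ (l + 2)


/-- Quadratic form. -/
noncomputable def bpA (x t y θ : ℝ) : ℝ := (x - y) ^ 2 + t ^ 2 + 2 * x * y * (1 - Real.cos θ)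

lemma bpA_ge (x t y θ : ℝ) : t ^ 2 ≤ bpA x t y θ := by
  unfold bpA
  have h := Real.sin_sq_add_cos_sq θ
  have : (x - y) ^ 2 + t ^ 2 + 2 * x * y * (1 - Real.cos θ) = t ^ 2 + (x - y * Real.cos θ) ^ 2 + (y * Real.sin θ) ^ 2 := by
    linear_combination (-y ^ 2) * h
  rw [this]; nlinarith [sq_nonneg (x - y * Real.cos θ), sq_nonneg (y * Real.sin θ)]

lemma bpA_pos {t : ℝ} (ht : 0 < t) (x y θ : ℝ) : 0 < bpA x t y θ :=
  lt_of_lt_of_le (by positivity) (bpA_ge x t y θ)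

lemma bpA_ge' {x y : ℝ} (hx : 0 < x) (hy : 0 < y) (t θ : ℝ) :
    (x - y) ^ 2 + t ^ 2 ≤ bpA x t y θ := by
  unfold bpA
  have := Real.cos_le_one θ
  have : 0 ≤ 2 * x * y * (1 - Real.cos θ) := mul_nonneg (by positivity) (by linarith)
  linarith

lemma bpA_cont (x t y : ℝ) : Continuous (bpA x t y) := by
  unfold bpA; fun_prop

lemma bpA_rpow_cont {t : ℝ} (ht : 0 < t) (x y p : ℝ) :
    Continuous fun θ => bpA x t y θ ^ p :=
  (bpA_cont x t y).rpow_const fun θ => Or.inl (bpA_pos ht x y θ).ne'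

/-- weight integrable -/
lemma sin_rpow_int {l : ℝ} (hl : 0 < l) :
    IntervalIntegrable (fun θ => Real.sin θ ^ (2 * l - 1)) volume 0 π := by
  have h1 : IntervalIntegrable (fun θ => Real.sin θ ^ (2 * l - 1)) volume 0 (π / 2) := by
    have hg : IntervalIntegrable (fun θ : ℝ => (2 / π) ^ (2 * l - 1) * θ ^ (2 * l - 1) + 1)
        volume 0 (π / 2) :=
      ((intervalIntegral.intervalIntegrable_rpow' (by linarith)).const_mul _).add
        intervalIntegrable_const
    refine hg.mono_fun ?_ ?_
    · exact (Measurable.pow_const Real.measurable_sin _).aestronglyMeasurable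
    · rw [uIoc_of_le (by positivity)]
      refine (ae_restrict_mem measurableSet_Ioc).mono fun θ hθ => ?_
      have hs : 0 < Real.sin θ := Real.sin_pos_of_pos_of_lt_pi hθ.1 (by linarith [hθ.2, Real.pi_pos])
      have hθ0 := hθ.1
      beta_reduce
      rw [Real.norm_of_nonneg (by positivity), Real.norm_of_nonneg (by positivity)]
      rcases le_or_gt 0 (2 * l - 1) with h | h
      · have := Real.rpow_le_one hs.le (Real.sin_le_one θ) h
        have : 0 ≤ (2 / π) ^ (2 * l - 1) * θ ^ (2 * l - 1) := by positivity
        linarith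
      · have := Real.mul_le_sin hθ.1.le hθ.2
        have := Real.rpow_le_rpow_of_nonpos (by positivity) this h.le
        rw [Real.mul_rpow (by positivity) hθ.1.le] at this
        linarith
  refine h1.trans ?_
  have h2 := h1.comp_sub_left π
  simp only [Real.sin_pi_sub, sub_zero] at h2
  rw [show π - π / 2 = π / 2 by ring] at h2
  exact h2.symm

lemma sin_rpow_mul_int {l : ℝ} (hl : 0 < l) {f : ℝ → ℝ} (hf : Continuous f) :
    IntervalIntegrable (fun θ => Real.sin θ ^ (2 * l - 1) * f θ) volume 0 π :=
  (sin_rpow_int hl).mul_continuousOn hf.continuousOn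

noncomputable def bpG (l x t y : ℝ) : ℝ :=
  ∫ θ in (0:ℝ)..π, Real.sin θ ^ (2 * l - 1) * (Real.cos θ * bpA x t y θ ^ (-(l + 1)))

noncomputable def bpG' (l x t y : ℝ) : ℝ :=
  ∫ θ in (0:ℝ)..π, Real.sin θ ^ (2 * l - 1) *
    (Real.cos θ * ((2 * y - 2 * x * Real.cos θ) * (-(l + 1)) * bpA x t y θ ^ (-(l + 2))))

lemma bpG_hasDeriv {l x t : ℝ} (hl : 0 < l) (hx : 0 < x) (ht : 0 < t) (y : ℝ) :
    HasDerivAt (bpG l x t) (bpG' l x t y) y := by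
  have hcont : ∀ y p : ℝ, Continuous fun θ => bpA x t y θ ^ p := fun y p => bpA_rpow_cont ht x y p
  have hw := sin_rpow_int hl
  refine (intervalIntegral.hasDerivAt_integral_of_dominated_loc_of_deriv_le
    (F := fun y θ => Real.sin θ ^ (2 * l - 1) * (Real.cos θ * bpA x t y θ ^ (-(l + 1))))
    (F' := fun y θ => Real.sin θ ^ (2 * l - 1) *
    (Real.cos θ * ((2 * y - 2 * x * Real.cos θ) * (-(l + 1)) * bpA x t y θ ^ (-(l + 2)))))
    (bound := fun θ => Real.sin θ ^ (2 * l - 1) *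
      ((2 * (|y| + 1) + 2 * x) * (l + 1) * (t ^ 2) ^ (-(l + 2))))
    (Metric.ball_mem_nhds y one_pos) ?_ ?_ ?_ ?_ ?_ ?_).2
  · refine Filter.Eventually.of_forall fun z => ?_
    exact ((sin_rpow_mul_int hl (Real.continuous_cos.mul (hcont z _))).def').aestronglyMeasurable
  · exact sin_rpow_mul_int hl (Real.continuous_cos.mul (hcont y _))
  · have h1 : Continuous fun θ => (Real.cos θ * ((2 * y - 2 * x * Real.cos θ) * (-(l + 1)) * bpA x t y θ ^ (-(l + 2)))) := by
      have := hcont y (-(l+2))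
      fun_prop
    exact ((sin_rpow_mul_int hl h1).def').aestronglyMeasurable
  · refine Filter.Eventually.of_forall fun θ hθ z hz => ?_
    rw [uIoc_of_le Real.pi_pos.le] at hθ
    have hs : 0 ≤ Real.sin θ := Real.sin_nonneg_of_nonneg_of_le_pi hθ.1.le hθ.2
    have hz' : |z| ≤ |y| + 1 := by
      rw [Metric.mem_ball, Real.dist_eq] at hz
      have := abs_sub_abs_le_abs_sub z y
      linarith
    have hA := bpA_pos ht x z θ
    rw [norm_mul, norm_mul, norm_mul, norm_mul, Real.norm_of_nonneg (Real.rpow_nonneg hs _),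
      Real.norm_of_nonneg (Real.rpow_nonneg hA.le _), norm_neg, Real.norm_of_nonneg (by linarith : 0 ≤ l + 1)]
    have h1 : bpA x t z θ ^ (-(l + 2)) ≤ (t ^ 2) ^ (-(l + 2)) :=
      Real.rpow_le_rpow_of_nonpos (by positivity) (bpA_ge x t z θ) (by linarith)
    have h2 : ‖2 * z - 2 * x * Real.cos θ‖ ≤ 2 * (|y| + 1) + 2 * x := by
      rw [Real.norm_eq_abs]
      have := Real.abs_cos_le_one θ
      calc |2 * z - 2 * x * Real.cos θ| ≤ |2 * z| + |2 * x * Real.cos θ| := abs_sub _ _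
        _ = 2 * |z| + 2 * x * |Real.cos θ| := by
            rw [abs_mul, abs_mul, abs_of_pos (by positivity : 0 < 2 * x)]; norm_num
        _ ≤ _ := by nlinarith
    have h3 : ‖Real.cos θ‖ ≤ 1 := Real.abs_cos_le_one θ
    refine mul_le_mul_of_nonneg_left ?_ (Real.rpow_nonneg hs _)
    calc _ ≤ 1 * ((2 * (|y| + 1) + 2 * x) * (l + 1) * (t ^ 2) ^ (-(l + 2))) := by gcongr
      _ = _ := one_mul _
  · exact hw.mul_const _
  · refine Filter.Eventually.of_forall fun θ hθ z hz => ?_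
    have hA := bpA_pos ht x z θ
    have h0 : HasDerivAt (fun y => bpA x t y θ) (2 * z - 2 * x * Real.cos θ) z := by
      unfold bpA
      have := (((((hasDerivAt_id z).const_sub x).pow 2).add_const (t^2)).add
        (((hasDerivAt_id z).const_mul (2*x)).mul_const (1 - Real.cos θ)))
      refine this.congr_deriv ?_
      simp; ring
    have h1 := h0.rpow_const (p := -(l+1)) (Or.inl hA.ne')
    rw [show -(l + 1) - 1 = -(l + 2) by ring] at h1
    exact (h1.const_mul _).const_mul _

lemma bp_ibp {l x t : ℝ} (hl : 0 < l) (ht : 0 < t) (y : ℝ) :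
    2 * l * bpG l x t y + ∫ θ in (0:ℝ)..π, Real.sin θ ^ (2 * l - 1) *
      (Real.sin θ * (2 * x * y * Real.sin θ * (-(l + 1)) * bpA x t y θ ^ (-(l + 2)))) = 0 := by
  have hcont : ∀ y p : ℝ, Continuous fun θ => bpA x t y θ ^ p := fun y p => bpA_rpow_cont ht x y p
  have hc1 := hcont y (-(l+1))
  have hc2 := hcont y (-(l+2))
  have i1 := (sin_rpow_mul_int hl (f := fun θ => Real.cos θ * bpA x t y θ ^ (-(l + 1))) (by fun_prop)).const_mul (2 * l)
  have i2 := sin_rpow_mul_int hl (f := fun θ =>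
    (Real.sin θ * (2 * x * y * Real.sin θ * (-(l + 1)) * bpA x t y θ ^ (-(l + 2))))) (by fun_prop)
  have key := intervalIntegral.integral_eq_sub_of_hasDerivAt_of_le Real.pi_pos.le
    (f := fun θ => Real.sin θ ^ (2 * l) * bpA x t y θ ^ (-(l + 1)))
    ?_ ?_ (i1.add i2)
  · rw [intervalIntegral.integral_add i1 i2, intervalIntegral.integral_const_mul] at key
    unfold bpG
    rw [key]
    simp [Real.zero_rpow (by positivity : 2 * l ≠ 0)]
  · exact ((Real.continuous_sin.rpow_const fun θ => Or.inr (by positivity)).mul hc1).continuousOn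
  · intro θ hθ
    have hs : 0 < Real.sin θ := Real.sin_pos_of_pos_of_lt_pi hθ.1 hθ.2
    have hA := bpA_pos ht x y θ
    have h0 : HasDerivAt (fun θ => bpA x t y θ) (2 * x * y * Real.sin θ) θ := by
      unfold bpA
      have := (((Real.hasDerivAt_cos θ).const_sub 1).const_mul (2*x*y)).const_add ((x-y)^2+t^2)
      refine this.congr_deriv ?_
      ring
    have h1 := h0.rpow_const (p := -(l+1)) (Or.inl hA.ne')
    rw [show -(l + 1) - 1 = -(l + 2) by ring] at h1
    have h2 := (Real.hasDerivAt_sin θ).rpow_const (p := 2 * l) (Or.inl hs.ne')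
    refine (h2.mul h1).congr_deriv ?_
    have : Real.sin θ ^ (2 * l) = Real.sin θ ^ (2 * l - 1) * Real.sin θ := by
      rw [← Real.rpow_add_one hs.ne']; congr 1; ring
    rw [this]; ring

/-- the inner kernel -/
noncomputable def bpK (l x t y : ℝ) : ℝ :=
  ∫ θ in (0:ℝ)..π, Real.sin θ ^ (2 * l - 1) * ((x - y * Real.cos θ) * bpA x t y θ ^ (-(l + 2)))

lemma bpK_eq {l x t : ℝ} (hl : 0 < l) (ht : 0 < t) (y : ℝ) :
    2 * (l + 1) * (y * bpK l x t y) = y * bpG' l x t y + 2 * l * bpG l x t y := by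
  have hc2 := bpA_rpow_cont ht x y (-(l+2))
  have h := bp_ibp (x := x) hl ht y
  have i1 := sin_rpow_mul_int hl (f := fun θ => (x - y * Real.cos θ) * bpA x t y θ ^ (-(l + 2))) (by fun_prop)
  have i2 := sin_rpow_mul_int hl (f := fun θ =>
    (Real.sin θ * (2 * x * y * Real.sin θ * (-(l + 1)) * bpA x t y θ ^ (-(l + 2))))) (by fun_prop)
  have i3 := sin_rpow_mul_int hl (f := fun θ => 
    (Real.cos θ * ((2 * y - 2 * x * Real.cos θ) * (-(l + 1)) * bpA x t y θ ^ (-(l + 2))))) (by fun_prop)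
  have : 2 * l * bpG l x t y = - ∫ θ in (0:ℝ)..π, Real.sin θ ^ (2 * l - 1) *
      (Real.sin θ * (2 * x * y * Real.sin θ * (-(l + 1)) * bpA x t y θ ^ (-(l + 2)))) := by linarith
  rw [this, ← sub_eq_add_neg]
  unfold bpK bpG'
  rw [← intervalIntegral.integral_const_mul, ← intervalIntegral.integral_const_mul,
    ← intervalIntegral.integral_const_mul, ← intervalIntegral.integral_sub (i3.const_mul y) i2]
  refine intervalIntegral.integral_congr fun θ _ => ?_
  have := Real.sin_sq θ
  linear_combination (-2 * (l+1) * x * y * Real.sin θ ^ (2 * l - 1) * bpA x t y θ ^ (-(l + 2))) * this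

lemma bpS_nonneg (l : ℝ) : 0 ≤ ∫ θ in (0:ℝ)..π, Real.sin θ ^ (2 * l - 1) :=
  intervalIntegral.integral_nonneg Real.pi_pos.le fun θ hθ =>
    Real.rpow_nonneg (Real.sin_nonneg_of_nonneg_of_le_pi hθ.1 hθ.2) _

lemma bpG_bound1 {l x t y : ℝ} (hl : 0 < l) (hx : 0 < x) (ht : 0 < t) (hy : 0 < y) :
    |bpG l x t y| ≤ (∫ θ in (0:ℝ)..π, Real.sin θ ^ (2 * l - 1)) *
      ((x - y) ^ 2 + t ^ 2) ^ (-(l + 1)) := by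
  rw [← intervalIntegral.integral_mul_const, ← Real.norm_eq_abs]
  refine intervalIntegral.norm_integral_le_of_norm_le Real.pi_pos.le
    (Filter.Eventually.of_forall fun θ hθ => ?_) ((sin_rpow_int hl).mul_const _)
  have hs : 0 ≤ Real.sin θ := Real.sin_nonneg_of_nonneg_of_le_pi hθ.1.le hθ.2
  have hA := bpA_pos ht x y θ
  rw [norm_mul, norm_mul, Real.norm_of_nonneg (Real.rpow_nonneg hs _),
      Real.norm_of_nonneg (Real.rpow_nonneg hA.le _)]
  refine mul_le_mul_of_nonneg_left ?_ (Real.rpow_nonneg hs _)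
  have h1 : bpA x t y θ ^ (-(l + 1)) ≤ ((x - y) ^ 2 + t ^ 2) ^ (-(l + 1)) :=
    Real.rpow_le_rpow_of_nonpos (by positivity) (bpA_ge' hx hy t θ) (by linarith)
  have h3 : ‖Real.cos θ‖ ≤ 1 := Real.abs_cos_le_one θ
  calc _ ≤ 1 * ((x - y) ^ 2 + t ^ 2) ^ (-(l + 1)) := by gcongr
    _ = _ := one_mul _

lemma bpG_bound2 {l x t y : ℝ} (hl : 0 < l) (hx : 0 < x) (ht : 0 < t) (hy : 0 < y) :
    |bpG l x t y| ≤ (2 ^ l / l + ∫ θ in (0:ℝ)..π, Real.sin θ ^ (2 * l - 1)) /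
      (((x - y) ^ 2 + t ^ 2) * (x * y) ^ l) := by
  set S := ∫ θ in (0:ℝ)..π, Real.sin θ ^ (2 * l - 1) with hS
  set a := (x - y) ^ 2 + t ^ 2 with ha
  have ha0 : 0 < a := by positivity
  have hxy : 0 < x * y := by positivity
  let g : ℝ → ℝ := fun θ => (1 - Real.cos θ) ^ l * bpA x t y θ ^ (-l)
  let g' : ℝ → ℝ := fun θ => l * a * (Real.sin θ * (1 - Real.cos θ) ^ (l - 1) *
    bpA x t y θ ^ (-(l + 1)))
  have hw : ∀ θ ∈ Ioo 0 π, 0 < 1 - Real.cos θ := fun θ hθ => by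
    have := Real.cos_lt_cos_of_nonneg_of_le_pi le_rfl hθ.2.le hθ.1
    rw [Real.cos_zero] at this; linarith
  have hgc : ContinuousOn g (Icc 0 π) := by
    refine Continuous.continuousOn (Continuous.mul ?_ (bpA_rpow_cont ht x y _))
    exact (continuous_const.sub Real.continuous_cos).rpow_const fun θ => Or.inr hl.le
  have hgd : ∀ θ ∈ Ioo 0 π, HasDerivAt g (g' θ) θ := by
    intro θ hθ
    have hA := bpA_pos ht x y θ
    have hw0 := hw θ hθ
    have hd : HasDerivAt (fun θ => 1 - Real.cos θ) (Real.sin θ) θ := by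
      simpa using (Real.hasDerivAt_cos θ).const_sub 1
    have h0 : HasDerivAt (fun θ => bpA x t y θ) (2 * x * y * Real.sin θ) θ := by
      unfold bpA
      exact (hd.const_mul (2*x*y)).const_add ((x-y)^2+t^2)
    refine ((hd.rpow_const (p := l) (Or.inl hw0.ne')).mul
      (h0.rpow_const (p := -l) (Or.inl hA.ne'))).congr_deriv ?_
    simp only [g']
    have e1 : (1 - Real.cos θ) ^ l = (1 - Real.cos θ) ^ (l - 1) * (1 - Real.cos θ) := by
      rw [← Real.rpow_add_one hw0.ne']; congr 1; ring
    have e2 : bpA x t y θ ^ (-l) = bpA x t y θ ^ (-(l + 1)) * bpA x t y θ := by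
      rw [← Real.rpow_add_one hA.ne']; congr 1; ring
    rw [e1, show -l - 1 = -(l + 1) by ring, e2]
    have e3 : bpA x t y θ = a + 2 * x * y * (1 - Real.cos θ) := rfl
    generalize bpA x t y θ ^ (-(l + 1)) = Q
    rw [e3]; ring
  have hg0 : ∀ θ ∈ Ioo 0 π, 0 ≤ g' θ := fun θ hθ => by
    have hs : 0 < Real.sin θ := Real.sin_pos_of_pos_of_lt_pi hθ.1 hθ.2
    have hA := bpA_pos ht x y θ
    have hw0 := hw θ hθ
    simp only [g']; positivity
  have hgi : IntervalIntegrable g' volume 0 π := by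
    rw [intervalIntegrable_iff_integrableOn_Ioc_of_le Real.pi_pos.le]
    exact intervalIntegral.integrableOn_deriv_of_nonneg hgc hgd hg0
  have hgI : ∫ θ in (0:ℝ)..π, g' θ ≤ ((x * y) ^ l)⁻¹ := by
    rw [intervalIntegral.integral_eq_sub_of_hasDerivAt_of_le Real.pi_pos.le hgc hgd hgi]
    have : g 0 = 0 := by simp [g, Real.zero_rpow hl.ne']
    rw [this, sub_zero]
    simp only [g]
    have hA := bpA_pos ht x y π
    rw [Real.rpow_neg hA.le, ← div_eq_mul_inv, Real.cos_pi, ← one_div,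
      div_le_div_iff₀ (by positivity) (by positivity), ← Real.mul_rpow (by norm_num) hxy.le, one_mul]
    refine Real.rpow_le_rpow (by positivity) ?_ hl.le
    have : bpA x t y π = a + 2 * x * y * (1 - Real.cos π) := rfl
    rw [this, Real.cos_pi]; nlinarith
  have hmain : |bpG l x t y| ≤ ∫ θ in (0:ℝ)..π, (2 ^ l / (l * a) * g' θ +
      Real.sin θ ^ (2 * l - 1) * (a * (x * y) ^ l)⁻¹) := by
    rw [← Real.norm_eq_abs]
    refine intervalIntegral.norm_integral_le_of_norm_le Real.pi_pos.le
      ?_ ((hgi.const_mul _).add ((sin_rpow_int hl).mul_const _))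
    have hne : ∀ᵐ θ : ℝ, θ ≠ π := by simp [ae_iff]
    filter_upwards [hne] with θ hθπ hθ'
    have hθ : θ ∈ Ioo 0 π := ⟨hθ'.1, lt_of_le_of_ne hθ'.2 hθπ⟩
    have hs : 0 < Real.sin θ := Real.sin_pos_of_pos_of_lt_pi hθ.1 hθ.2
    have hA := bpA_pos ht x y θ
    have hw0 := hw θ hθ
    have hg00 := hg0 θ hθ
    have h3 : ‖Real.cos θ‖ ≤ 1 := Real.abs_cos_le_one θ
    have step : ‖Real.sin θ ^ (2 * l - 1) * (Real.cos θ * bpA x t y θ ^ (-(l + 1)))‖ ≤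
        Real.sin θ ^ (2 * l - 1) * bpA x t y θ ^ (-(l + 1)) := by
      rw [norm_mul, norm_mul, Real.norm_of_nonneg (Real.rpow_nonneg hs.le _),
        Real.norm_of_nonneg (Real.rpow_nonneg hA.le _)]
      refine mul_le_mul_of_nonneg_left ?_ (Real.rpow_nonneg hs.le _)
      exact mul_le_of_le_one_left (by positivity) h3
    refine step.trans ?_
    rcases le_total 0 (Real.cos θ) with hc | hc
    · have h4 : Real.sin θ ^ (2 * l - 1) ≤ 2 ^ l * (Real.sin θ * (1 - Real.cos θ) ^ (l - 1)) := by
        have e1 : Real.sin θ ^ (2 * l - 1) = Real.sin θ * ((1 - Real.cos θ) ^ (l - 1) *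
            (1 + Real.cos θ) ^ (l - 1)) := by
          rw [← Real.mul_rpow hw0.le (by linarith),
            show (1 - Real.cos θ) * (1 + Real.cos θ) = Real.sin θ ^ (2 : ℝ) by
              rw [Real.rpow_two, Real.sin_sq]; ring,
            ← Real.rpow_mul hs.le, mul_comm (Real.sin θ), ← Real.rpow_add_one hs.ne']
          congr 1; ring
        have e2 : (1 + Real.cos θ) ^ (l - 1) ≤ 2 ^ l := by
          calc (1 + Real.cos θ) ^ (l - 1) ≤ (1 + Real.cos θ) ^ l :=
                Real.rpow_le_rpow_of_exponent_le (by linarith) (by linarith)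
            _ ≤ 2 ^ l := Real.rpow_le_rpow (by linarith) (by linarith [Real.cos_le_one θ]) hl.le
        rw [e1]
        calc _ ≤ Real.sin θ * ((1 - Real.cos θ) ^ (l - 1) * 2 ^ l) := by gcongr
          _ = _ := by ring
      have h5 : 0 ≤ Real.sin θ ^ (2 * l - 1) * (a * (x * y) ^ l)⁻¹ := by positivity
      have h6 : 2 ^ l / (l * a) * g' θ = 2 ^ l * (Real.sin θ * (1 - Real.cos θ) ^ (l - 1)) *
          bpA x t y θ ^ (-(l + 1)) := by
        simp only [g']; field_simp
      rw [h6]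
      have := mul_le_mul_of_nonneg_right h4 (Real.rpow_nonneg hA.le (-(l + 1)))
      linarith
    · have h5 : 0 ≤ 2 ^ l / (l * a) * g' θ := by positivity
      have h6 : bpA x t y θ ^ (-(l + 1)) ≤ (a * (x * y) ^ l)⁻¹ := by
        rw [Real.rpow_neg hA.le]
        refine inv_anti₀ (by positivity) ?_
        rw [Real.rpow_add_one hA.ne', mul_comm]
        have : x * y ≤ bpA x t y θ := by
          have : bpA x t y θ = a + 2 * x * y * (1 - Real.cos θ) := rfl
          rw [this]; nlinarith
        have := bpA_ge' hx hy t θ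
        gcongr
      have := mul_le_mul_of_nonneg_left h6 (Real.rpow_nonneg hs.le (2 * l - 1))
      linarith
  refine hmain.trans ?_
  rw [intervalIntegral.integral_add (hgi.const_mul _) ((sin_rpow_int hl).mul_const _),
    intervalIntegral.integral_const_mul, intervalIntegral.integral_mul_const, ← hS]
  calc _ ≤ 2 ^ l / (l * a) * ((x * y) ^ l)⁻¹ + S * (a * (x * y) ^ l)⁻¹ := by gcongr
    _ = _ := by field_simp

lemma cauchy_int {x t : ℝ} (ht : 0 < t) :
    Integrable (fun y : ℝ => t / ((x - y) ^ 2 + t ^ 2)) ∧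
      ∫ y : ℝ, t / ((x - y) ^ 2 + t ^ 2) = π := by
  have e : (fun y : ℝ => t / ((x - y) ^ 2 + t ^ 2)) =
      fun y => t⁻¹ * (fun z : ℝ => (fun z : ℝ => (1 + z ^ 2)⁻¹) (z / t)) (y - x) := by
    funext y
    have : 0 < (x - y) ^ 2 + t ^ 2 := by positivity
    have h2 : 1 + ((y - x) / t) ^ 2 = ((x - y) ^ 2 + t ^ 2) / t ^ 2 := by field_simp; ring
    simp only [h2]
    field_simp
  rw [e]
  constructor
  · exact ((integrable_inv_one_add_sq.comp_div ht.ne').comp_sub_right x).const_mul _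
  · rw [integral_const_mul, integral_sub_right_eq_self (fun z : ℝ => (fun z : ℝ => (1 + z ^ 2)⁻¹) (z / t)) x,
      Measure.integral_comp_div (fun z : ℝ => (1 + z ^ 2)⁻¹) t, integral_univ_inv_one_add_sq, abs_of_pos ht, smul_eq_mul]
    field_simp

lemma bp_q {l : ℝ} (hl : 0 < l) : ∃ C > 0, ∀ x t : ℝ, 0 < x → 0 < t →
    IntegrableOn (fun y => y ^ (l - 1) * bpG l x t y) (Ioi 0) ∧
    x ^ l * t * |∫ y in Ioi (0:ℝ), y ^ (l - 1) * bpG l x t y| ≤ C / (x + t) := by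
  set S := ∫ θ in (0:ℝ)..π, Real.sin θ ^ (2 * l - 1) with hS
  have hS0 : 0 ≤ S := bpS_nonneg l
  set C2 := 2 ^ l / l + S with hC2
  have hC20 : 0 < C2 := by positivity
  refine ⟨S * 16 ^ (l + 1) / l + 4 * C2 * π, by positivity, fun x t hx ht => ?_⟩
  set M := x + t with hM
  have hM0 : 0 < M := by positivity
  set k := S * 16 ^ (l + 1) * M ^ (-(l + 1)) with hk
  have hk0 : 0 ≤ k := by positivity
  set m1 : ℝ → ℝ := (Ioc 0 (M / 4)).indicator (fun y => k * y ^ (l - 1)) with hm1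
  set m2 : ℝ → ℝ := fun y => 4 / M * C2 * (t / ((x - y) ^ 2 + t ^ 2)) with hm2
  have hr : IntegrableOn (fun y : ℝ => k * y ^ (l - 1)) (Ioc 0 (M / 4)) := by
    have := (intervalIntegral.intervalIntegrable_rpow' (a := 0) (b := M / 4) (r := l - 1) (by linarith)).const_mul k
    rwa [intervalIntegrable_iff_integrableOn_Ioc_of_le (by positivity)] at this
  have him1 : Integrable m1 := hr.integrable_indicator measurableSet_Ioc
  have him2 : Integrable m2 := (cauchy_int ht).1.const_mul _
  have hI1 : ∫ y, m1 y ≤ S * 16 ^ (l + 1) / l / M := by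
    rw [hm1, integral_indicator measurableSet_Ioc, ← intervalIntegral.integral_of_le (by positivity),
      intervalIntegral.integral_const_mul, integral_rpow (Or.inl (by linarith)), sub_add_cancel,
      Real.zero_rpow hl.ne', sub_zero, hk]
    have : (M / 4) ^ l ≤ M ^ l := Real.rpow_le_rpow (by positivity) (by linarith) hl.le
    calc _ ≤ S * 16 ^ (l + 1) * M ^ (-(l + 1)) * (M ^ l / l) := by gcongr
      _ = _ := by
        rw [Real.rpow_neg hM0.le, Real.rpow_add_one hM0.ne']; field_simp
  have hI2 : ∫ y, m2 y = 4 * C2 * π / M := by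
    rw [hm2, integral_const_mul, (cauchy_int ht).2]; ring
  have hn1 : ∀ y, 0 ≤ m1 y := fun y => indicator_nonneg (fun z hz => by
    have := hz.1
    positivity) y
  have hn2 : ∀ y, 0 ≤ m2 y := fun y => by simp only [hm2]; positivity
  have hbd : ∀ y ∈ Ioi (0:ℝ), x ^ l * t * |y ^ (l - 1) * bpG l x t y| ≤ m1 y + m2 y := by
    intro y hy
    have hy : 0 < y := hy
    rw [abs_mul, abs_of_pos (Real.rpow_pos_of_pos hy _)]
    rcases le_or_gt y (M / 4) with h | h
    · have : m1 y = k * y ^ (l - 1) := indicator_of_mem (show y ∈ Ioc 0 (M / 4) from ⟨hy, h⟩) _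
      have hb := bpG_bound1 hl hx ht hy
      have hge : M ^ 2 / 16 ≤ (x - y) ^ 2 + t ^ 2 := by
        rcases le_or_gt (M / 4) t with h' | h'
        · nlinarith [sq_nonneg (x - y)]
        · have : M / 4 ≤ x - y := by linarith
          nlinarith [sq_nonneg t]
      have h1 : ((x - y) ^ 2 + t ^ 2) ^ (-(l + 1)) ≤ (M ^ 2 / 16) ^ (-(l + 1)) :=
        Real.rpow_le_rpow_of_nonpos (by positivity) hge (by linarith)
      have h2 : (M ^ 2 / 16) ^ (-(l + 1)) = 16 ^ (l + 1) * M ^ (-(l + 1)) * M ^ (-(l + 1)) := by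
        rw [Real.div_rpow (by positivity) (by norm_num), Real.rpow_neg (by norm_num : (0:ℝ) ≤ 16),
          sq, Real.mul_rpow hM0.le hM0.le]
        field_simp
      have h3 : x ^ l * t ≤ M ^ (l + 1) := by
        rw [Real.rpow_add_one hM0.ne']
        have : x ^ l ≤ M ^ l := Real.rpow_le_rpow hx.le (by linarith) hl.le
        have : t ≤ M := by linarith
        gcongr
      have h4 : M ^ (l + 1) * M ^ (-(l + 1)) = 1 := by
        rw [← Real.rpow_add hM0]; simp
      calc x ^ l * t * (y ^ (l - 1) * |bpG l x t y|)
          ≤ M ^ (l + 1) * (y ^ (l - 1) * (S * (16 ^ (l + 1) * M ^ (-(l + 1)) * M ^ (-(l + 1))))) := by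
            have := h2 ▸ h1
            have h5 := hb.trans (mul_le_mul_of_nonneg_left this hS0)
            gcongr
        _ = (M ^ (l + 1) * M ^ (-(l + 1))) * (k * y ^ (l - 1)) := by rw [hk]; ring
        _ = m1 y := by rw [h4, this, one_mul]
        _ ≤ _ := by linarith [hn2 y]
    · have hb := bpG_bound2 hl hx ht hy
      rw [← hS, ← hC2] at hb
      have hyl : y ^ (l - 1) = y ^ l / y := Real.rpow_sub_one hy.ne' l
      calc x ^ l * t * (y ^ (l - 1) * |bpG l x t y|)
          ≤ x ^ l * t * (y ^ (l - 1) * (C2 / (((x - y) ^ 2 + t ^ 2) * (x * y) ^ l))) := by gcongr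
        _ = y⁻¹ * C2 * (t / ((x - y) ^ 2 + t ^ 2)) := by
            rw [hyl, Real.mul_rpow hx.le hy.le]; field_simp
        _ ≤ m2 y := by
            simp only [hm2]
            have : y⁻¹ ≤ 4 / M := by
              rw [inv_le_comm₀ hy (by positivity), inv_div]; exact h.le
            gcongr
        _ ≤ _ := by linarith [hn1 y]
  have hxt : 0 < x ^ l * t := by positivity
  have hmeas : AEStronglyMeasurable (fun y => y ^ (l - 1) * bpG l x t y) (volume.restrict (Ioi 0)) := by
    have hc : Continuous (bpG l x t) := continuous_iff_continuousAt.2 fun y =>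
      (bpG_hasDeriv hl hx ht y).continuousAt
    exact ((measurable_id.pow_const (l - 1)).mul hc.measurable).aestronglyMeasurable
  have hint : IntegrableOn (fun y => y ^ (l - 1) * bpG l x t y) (Ioi 0) := by
    refine Integrable.mono' (((him1.add him2).const_mul (x ^ l * t)⁻¹).integrableOn) hmeas ?_
    refine (ae_restrict_mem measurableSet_Ioi).mono fun y hy => ?_
    rw [Real.norm_eq_abs, inv_mul_eq_div, le_div_iff₀ hxt, mul_comm]
    exact hbd y hy
  refine ⟨hint, ?_⟩
  calc x ^ l * t * |∫ y in Ioi (0:ℝ), y ^ (l - 1) * bpG l x t y|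
      ≤ x ^ l * t * ∫ y in Ioi (0:ℝ), |y ^ (l - 1) * bpG l x t y| := by
        gcongr; exact abs_integral_le_integral_abs
    _ = ∫ y in Ioi (0:ℝ), x ^ l * t * |y ^ (l - 1) * bpG l x t y| := by rw [integral_const_mul]
    _ ≤ ∫ y in Ioi (0:ℝ), (m1 y + m2 y) :=
        setIntegral_mono_on (hint.abs.const_mul _) (him1.add him2).integrableOn measurableSet_Ioi hbd
    _ ≤ ∫ y, (m1 y + m2 y) := setIntegral_le_integral (him1.add him2)
        (Filter.Eventually.of_forall fun y => add_nonneg (hn1 y) (hn2 y))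
    _ = (∫ y, m1 y) + ∫ y, m2 y := integral_add him1 him2
    _ ≤ S * 16 ^ (l + 1) / l / M + 4 * C2 * π / M := by rw [hI2]; gcongr
    _ = _ := by ring

lemma bp_parts {l x t : ℝ} (hl : 0 < l) (hx : 0 < x) (ht : 0 < t)
    (hq : IntegrableOn (fun y => y ^ (l - 1) * bpG l x t y) (Ioi 0))
    (hK : IntegrableOn (fun y => y ^ l * bpK l x t y) (Ioi 0)) :
    2 * (l + 1) * ∫ y in Ioi (0:ℝ), y ^ l * bpK l x t y =
      l * ∫ y in Ioi (0:ℝ), y ^ (l - 1) * bpG l x t y := by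
  have hc : Continuous (bpG l x t) := continuous_iff_continuousAt.2 fun y =>
      (bpG_hasDeriv hl hx ht y).continuousAt
  have h1 := hK.const_mul (2 * (l + 1))
  have h2 := hq.const_mul l
  have key := integral_Ioi_of_hasDerivAt_of_tendsto (a := 0) (m := 0)
    (f := fun y => y ^ l * bpG l x t y)
    (f' := fun y => 2 * (l + 1) * (y ^ l * bpK l x t y) - l * (y ^ (l - 1) * bpG l x t y))
    ?_ ?_ (h1.sub h2) ?_
  · rw [integral_sub h1 h2, integral_const_mul, integral_const_mul] at key
    rw [Real.zero_rpow hl.ne'] at key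
    linarith
  · exact ((Real.continuous_rpow_const hl.le).mul hc).continuousWithinAt
  · intro y hy
    have hy : 0 < y := hy
    refine ((Real.hasDerivAt_rpow_const (p := l) (Or.inl hy.ne')).mul
      (bpG_hasDeriv hl hx ht y)).congr_deriv ?_
    have := bpK_eq (x := x) hl ht y
    have e : y ^ l = y ^ (l - 1) * y := by
      rw [← Real.rpow_add_one hy.ne']; congr 1; ring
    rw [e]
    linear_combination (- y ^ (l - 1)) * this
  · set C := (2 ^ l / l + ∫ θ in (0:ℝ)..π, Real.sin θ ^ (2 * l - 1)) / x ^ l with hC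
    have ht0 : Filter.Tendsto (fun y : ℝ => C / ((x - y) ^ 2 + t ^ 2)) Filter.atTop (nhds 0) := by
      refine Filter.Tendsto.const_div_atTop ?_ C
      refine Filter.tendsto_atTop_add_const_right _ _ ?_
      have : (fun y : ℝ => (x - y) ^ 2) = fun y => (y - x) ^ 2 := by funext y; ring
      rw [this]
      exact (Filter.tendsto_pow_atTop two_ne_zero).comp (Filter.tendsto_atTop_add_const_right _ (-x) Filter.tendsto_id)
    refine squeeze_zero_norm' ?_ ht0
    filter_upwards [Filter.eventually_gt_atTop 0] with y hy
    have hb := bpG_bound2 hl hx ht hy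
    rw [norm_mul, Real.norm_of_nonneg (Real.rpow_nonneg hy.le _), Real.norm_eq_abs]
    refine (mul_le_mul_of_nonneg_left hb (Real.rpow_nonneg hy.le _)).trans (le_of_eq ?_)
    rw [hC, Real.mul_rpow hx.le hy.le]
    field_simp

lemma Dx_eq {l x t y : ℝ} (hx : 0 < x) (ht : 0 < t) (hy : 0 < y) :
    DxBesselPoissonKernel l x y t =
      -(4 * l * (l + 1) / π) * x ^ l * t * (y ^ l * bpK l x t y) := by
  have : (∫ θ in (0:ℝ)..π, Real.sin θ ^ (2 * l - 1) * (x - y * Real.cos θ) /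
      ((x - y) ^ 2 + t ^ 2 + 2 * x * y * (1 - Real.cos θ)) ^ (l + 2)) = bpK l x t y := by
    unfold bpK
    refine intervalIntegral.integral_congr fun θ _ => ?_
    beta_reduce
    rw [Real.rpow_neg (bpA_pos ht x y θ).le]
    unfold bpA
    ring
  unfold DxBesselPoissonKernel
  rw [this, Real.mul_rpow hx.le hy.le]
  ring

/-- For `λ > 0`, `|∫₀^∞ D_{λ,x}P_t^λ(x,y) dy| ≤ C/(x+t)`, i.e.
`|t D_{λ,x}P_t^λ(1)(x)| ≤ C t/(x+t)`. -/
theorem statement2 (l : ℝ) (hl : 0 < l) :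
    ∃ C > 0, ∀ x t : ℝ, 0 < x → 0 < t →
      (|∫ y in Ioi (0:ℝ), DxBesselPoissonKernel l x y t| ≤ C / (x + t) ∧
        |t * ∫ y in Ioi (0:ℝ), DxBesselPoissonKernel l x y t| ≤ C * t / (x + t)) := by
  obtain ⟨C, hC, h⟩ := bp_q hl
  refine ⟨2 * l ^ 2 / π * C, by positivity, fun x t hx ht => ?_⟩
  obtain ⟨hq, hb⟩ := h x t hx ht
  have main : |∫ y in Ioi (0:ℝ), DxBesselPoissonKernel l x y t| ≤ 2 * l ^ 2 / π * C / (x + t) := by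
    rw [setIntegral_congr_fun measurableSet_Ioi (fun y hy => Dx_eq hx ht hy), integral_const_mul]
    by_cases hK : IntegrableOn (fun y => y ^ l * bpK l x t y) (Ioi 0)
    · have hp := bp_parts hl hx ht hq hK
      set I := ∫ y in Ioi (0:ℝ), y ^ l * bpK l x t y
      set J := ∫ y in Ioi (0:ℝ), y ^ (l - 1) * bpG l x t y
      have e : -(4 * l * (l + 1) / π) * x ^ l * t * I = -(2 * l ^ 2 / π * (x ^ l * t)) * J := by
        linear_combination (-(2 * l / π) * x ^ l * t) * hp
      rw [e, abs_mul, abs_neg, abs_of_pos (by positivity)]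
      calc _ = 2 * l ^ 2 / π * (x ^ l * t * |J|) := by ring
        _ ≤ 2 * l ^ 2 / π * (C / (x + t)) := by gcongr
        _ = _ := by ring
    · rw [integral_undef hK]
      simp only [mul_zero, abs_zero]
      positivity
  refine ⟨main, ?_⟩
  rw [abs_mul, abs_of_pos ht]
  calc _ ≤ t * (2 * l ^ 2 / π * C / (x + t)) := by gcongr
    _ = _ := by ring
end

section
/- For λ > 0 there exists C > 0 such that for every bounded interval J ⊂ (0,∞) with center x_J, (x_J + |J|)²/|J|³ · ∫₀^{|J|} ∫_J |t D_{λ,x} P_t^λ(1)(x)|² dx dt/t ≤ C. -/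
open MeasureTheory Real Set
theorem sinInt (l : ℝ) (hl : 0 < l) :
    IntervalIntegrable (fun θ : ℝ => Real.sin θ ^ (2 * l - 1)) volume 0 π := by
  have h1 : IntervalIntegrable (fun θ : ℝ => Real.sin θ ^ (2 * l - 1)) volume 0 (π / 2) := by
    have h := (intervalIntegral.intervalIntegrable_rpow' (a := 0) (b := π / 2)
      (r := 2 * l - 1) (by linarith)).mul_continuousOn
      (g := fun θ => Real.sinc θ ^ (2 * l - 1)) (by
        apply ContinuousOn.rpow_const Real.continuous_sinc.continuousOn
        intro θ hθ
        left
        rw [uIcc_of_le (by positivity)] at hθ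
        rcases eq_or_lt_of_le hθ.1 with h | h
        · rw [← h]; simp
        · rw [Real.sinc_of_ne_zero h.ne']
          have := Real.sin_pos_of_pos_of_lt_pi h (by linarith [hθ.2, Real.pi_pos])
          positivity)
    refine h.congr ?_
    intro θ hθ
    rw [uIoc_of_le (by positivity)] at hθ
    have := Real.sin_pos_of_pos_of_lt_pi hθ.1 (by linarith [hθ.2, Real.pi_pos])
    have h0 := hθ.1
    simp only
    rw [Real.sinc_of_ne_zero h0.ne', ← Real.mul_rpow h0.le (by positivity)]
    congr 1
    field_simp
  have h2 := h1.comp_sub_left π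
  simp only [Real.sin_pi_sub, sub_zero] at h2
  rw [show π - π / 2 = π / 2 by ring] at h2
  exact h1.trans h2.symm

theorem Qge (x y t θ : ℝ) (hx : 0 ≤ x) (hy : 0 ≤ y) :
    (x - y) ^ 2 + t ^ 2 ≤ (x - y) ^ 2 + t ^ 2 + 2 * x * y * (1 - Real.cos θ) := by
  have := Real.cos_le_one θ
  have : 0 ≤ 2 * x * y * (1 - Real.cos θ) := by
    apply mul_nonneg <;> [positivity; linarith]
  linarith

theorem Qpos (x y t θ : ℝ) (hx : 0 ≤ x) (hy : 0 ≤ y) (ht : 0 < t) :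
    0 < (x - y) ^ 2 + t ^ 2 + 2 * x * y * (1 - Real.cos θ) := by
  have := Qge x y t θ hx hy
  have : 0 < (x - y) ^ 2 + t ^ 2 := by positivity
  linarith

theorem wInt (l : ℝ) (hl : 0 < l) (g : ℝ → ℝ) (hg : Continuous g) :
    IntervalIntegrable (fun θ : ℝ => Real.sin θ ^ (2 * l - 1) * g θ) volume 0 π :=
  (sinInt l hl).mul_continuousOn hg.continuousOn

theorem Qcont (x y t p : ℝ) (hx : 0 ≤ x) (hy : 0 ≤ y) (ht : 0 < t) :
    Continuous (fun θ : ℝ => ((x - y) ^ 2 + t ^ 2 + 2 * x * y * (1 - Real.cos θ)) ^ p) := by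
  apply Continuous.rpow_const (by fun_prop)
  intro θ
  left
  exact (Qpos x y t θ hx hy ht).ne'

noncomputable def Afun (l x t y : ℝ) : ℝ :=
  ∫ θ in (0:ℝ)..π, Real.sin θ ^ (2 * l - 1) * (Real.cos θ *
      ((x - y) ^ 2 + t ^ 2 + 2 * x * y * (1 - Real.cos θ)) ^ (-(l + 1)))

noncomputable def Bfun (l x t y : ℝ) : ℝ :=
  ∫ θ in (0:ℝ)..π, Real.sin θ ^ (2 * l - 1) * 
      ((x - y) ^ 2 + t ^ 2 + 2 * x * y * (1 - Real.cos θ)) ^ (-(l + 1))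

noncomputable def Afun' (l x t y : ℝ) : ℝ :=
  ∫ θ in (0:ℝ)..π, Real.sin θ ^ (2 * l - 1) * (Real.cos θ *
      (2 * (y - x * Real.cos θ) * (-(l + 1)) *
      ((x - y) ^ 2 + t ^ 2 + 2 * x * y * (1 - Real.cos θ)) ^ (-(l + 1) - 1)))

theorem A_deriv (l x t y : ℝ) (hl : 0 < l) (hx : 0 < x) (ht : 0 < t) (hy : 0 < y) :
    HasDerivAt (Afun l x t) (Afun' l x t y) y := by
  unfold Afun'
  have hs : Ioo 0 (2 * y) ∈ nhds y := Ioo_mem_nhds hy (by linarith)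
  have key := intervalIntegral.hasDerivAt_integral_of_dominated_loc_of_deriv_le
    (μ := volume) (a := 0) (b := π)
    (F := fun y θ => Real.sin θ ^ (2 * l - 1) * (Real.cos θ *
      ((x - y) ^ 2 + t ^ 2 + 2 * x * y * (1 - Real.cos θ)) ^ (-(l + 1))))
    (F' := fun y θ => Real.sin θ ^ (2 * l - 1) * (Real.cos θ *
      (2 * (y - x * Real.cos θ) * (-(l + 1)) *
      ((x - y) ^ 2 + t ^ 2 + 2 * x * y * (1 - Real.cos θ)) ^ (-(l + 1) - 1))))
    (bound := fun θ => Real.sin θ ^ (2 * l - 1) *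
      (1 * (2 * (2 * y + x) * (l + 1) * (t ^ 2) ^ (-(l + 1) - 1))))
    (x₀ := y) hs ?_ ?_ ?_ ?_ ?_ ?_
  · exact key.2
  · filter_upwards [hs] with z hz
    have := wInt l hl _ ((Real.continuous_cos).mul (Qcont x z t (-(l + 1)) hx.le hz.1.le ht))
    exact (intervalIntegrable_iff.1 this).aestronglyMeasurable
  · exact wInt l hl _ ((Real.continuous_cos).mul (Qcont x y t (-(l + 1)) hx.le hy.le ht))
  · have hc := Qcont x y t (-(l + 1) - 1) hx.le hy.le ht
    have := wInt l hl (fun θ => (Real.cos θ *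
      (2 * (y - x * Real.cos θ) * (-(l + 1)) *
      ((x - y) ^ 2 + t ^ 2 + 2 * x * y * (1 - Real.cos θ)) ^ (-(l + 1) - 1)))) (by fun_prop)
    exact (intervalIntegrable_iff.1 this).aestronglyMeasurable
  · refine Filter.Eventually.of_forall fun θ hθ z hz => ?_
    rw [uIoc_of_le Real.pi_pos.le] at hθ
    have hsin := Real.sin_nonneg_of_nonneg_of_le_pi hθ.1.le hθ.2
    have hw : 0 ≤ Real.sin θ ^ (2 * l - 1) := Real.rpow_nonneg hsin _
    have hq := Qpos x z t θ hx.le hz.1.le ht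
    have hge := Qge x z t θ hx.le hz.1.le
    simp only [norm_mul, Real.norm_eq_abs, abs_of_nonneg hw]
    have h1 := Real.abs_cos_le_one θ
    have h2 : |z - x * Real.cos θ| ≤ 2 * y + x := by
      have h3 := abs_sub z (x * Real.cos θ)
      rw [abs_mul, abs_of_pos hx, abs_of_pos hz.1] at h3
      have := hz.2
      nlinarith
    have h4 : |-(l + 1)| = l + 1 := by rw [abs_neg, abs_of_pos (by linarith)]
    have h5 : |((x - z) ^ 2 + t ^ 2 + 2 * x * z * (1 - Real.cos θ)) ^ (-(l + 1) - 1)|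
        ≤ (t ^ 2) ^ (-(l + 1) - 1) := by
      rw [abs_of_nonneg (by positivity)]
      apply Real.rpow_le_rpow_of_nonpos (by positivity) _ (by linarith)
      nlinarith [sq_nonneg (x - z)]
    rw [h4, abs_of_pos (by norm_num : (0:ℝ) < 2)]
    gcongr
  · exact wInt l hl _ continuous_const
  · refine Filter.Eventually.of_forall fun θ hθ z hz => ?_
    have hq := Qpos x z t θ hx.le hz.1.le ht
    have h1 : HasDerivAt (fun z => (x - z) ^ 2 + t ^ 2 + 2 * x * z * (1 - Real.cos θ))
        (2 * (z - x * Real.cos θ)) z := by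
      have := ((((hasDerivAt_id z).const_sub x).pow 2).add_const (t ^ 2)).add
        (((hasDerivAt_id z).const_mul (2 * x)).mul_const (1 - Real.cos θ))
      refine this.congr_deriv ?_
      simp
      ring
    exact ((h1.rpow_const (Or.inl hq.ne')).const_mul _).const_mul _

/-- integration by parts in `θ` -/
theorem ibp_theta (l x t y : ℝ) (hl : 0 < l) (hx : 0 < x) (ht : 0 < t) (hy : 0 < y) :
    ∫ θ in (0:ℝ)..π, Real.sin θ ^ (2 * l - 1) * (2 * l * Real.cos θ *
      ((x - y) ^ 2 + t ^ 2 + 2 * x * y * (1 - Real.cos θ)) ^ (-(l + 1)) +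
      Real.sin θ ^ 2 * (2 * x * y * (-(l + 1)) *
      ((x - y) ^ 2 + t ^ 2 + 2 * x * y * (1 - Real.cos θ)) ^ (-(l + 1) - 1))) = 0 := by
  have hc := Qcont x y t (-(l + 1) - 1) hx.le hy.le ht
  have hc1 := Qcont x y t (-(l + 1)) hx.le hy.le ht
  rw [intervalIntegral.integral_eq_sub_of_hasDerivAt_of_le (f := fun θ => Real.sin θ ^ (2 * l) *
      ((x - y) ^ 2 + t ^ 2 + 2 * x * y * (1 - Real.cos θ)) ^ (-(l + 1))) Real.pi_pos.le]
  · simp [Real.zero_rpow (show 2 * l ≠ 0 by positivity)]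
  · apply Continuous.continuousOn
    exact (Real.continuous_sin.rpow_const (fun _ => Or.inr (by positivity))).mul hc1
  · intro θ hθ
    have hsin := Real.sin_pos_of_pos_of_lt_pi hθ.1 hθ.2
    have hq := Qpos x y t θ hx.le hy.le ht
    have h1 : HasDerivAt (fun θ => (x - y) ^ 2 + t ^ 2 + 2 * x * y * (1 - Real.cos θ))
        (2 * x * y * Real.sin θ) θ := by
      have := (((Real.hasDerivAt_cos θ).const_sub 1).const_mul (2 * x * y)).const_add
        ((x - y) ^ 2 + t ^ 2)
      refine this.congr_deriv ?_
      ring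
    have h2 := ((Real.hasDerivAt_sin θ).rpow_const (p := 2 * l) (Or.inl hsin.ne')).mul
      (h1.rpow_const (p := -(l + 1)) (Or.inl hq.ne'))
    refine h2.congr_deriv ?_
    have : Real.sin θ ^ (2 * l) = Real.sin θ ^ (2 * l - 1) * Real.sin θ := by
      rw [← Real.rpow_add_one hsin.ne']; congr 1; ring
    rw [this]
    ring
  · apply wInt l hl
    fun_prop

theorem key_identity (l x t y : ℝ) (hl : 0 < l) (hx : 0 < x) (ht : 0 < t) (hy : 0 < y) :
    DxBesselPoissonKernel l x y t = -(2 * l / π) * x ^ l * t *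
      ((l * y ^ (l - 1) * Afun l x t y + y ^ l * Afun' l x t y)
        + l * (y ^ (l - 1) * Afun l x t y)) := by
  have hc := Qcont x y t (-(l + 1) - 1) hx.le hy.le ht
  have hc1 := Qcont x y t (-(l + 1)) hx.le hy.le ht
  have h0 := ibp_theta l x t y hl hx ht hy
  have e1 : 2 * (l + 1) * y * (∫ θ in (0:ℝ)..π, Real.sin θ ^ (2 * l - 1) * (x - y * Real.cos θ) /
      ((x - y) ^ 2 + t ^ 2 + 2 * x * y * (1 - Real.cos θ)) ^ (l + 2)) = 
      2 * l * Afun l x t y + y * Afun' l x t y := by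
    unfold Afun Afun'
    rw [← intervalIntegral.integral_const_mul, ← intervalIntegral.integral_const_mul,
      ← intervalIntegral.integral_const_mul, ← intervalIntegral.integral_add,
      ← sub_eq_zero, ← intervalIntegral.integral_sub, ← neg_eq_zero,
      ← intervalIntegral.integral_neg]
    · refine Eq.trans ?_ h0
      apply intervalIntegral.integral_congr
      intro θ _
      have hq := Qpos x y t θ hx.le hy.le ht
      simp only
      rw [show (-(l + 1) - 1) = -(l + 2) by ring, div_eq_mul_inv, ← Real.rpow_neg hq.le]
      have := Real.sin_sq_add_cos_sq θ
      have hsq : Real.sin θ ^ 2 = 1 - Real.cos θ ^ 2 := by linarith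
      rw [hsq]
      ring
    · have := (wInt l hl (fun θ => (x - y * Real.cos θ) *
        ((x - y) ^ 2 + t ^ 2 + 2 * x * y * (1 - Real.cos θ)) ^ (-(l + 1) - 1)) 
          (by fun_prop)).const_mul (2 * (l + 1) * y)
      refine this.congr ?_
      intro θ _
      have hq := Qpos x y t θ hx.le hy.le ht
      simp only
      rw [show (-(l + 1) - 1) = -(l + 2) by ring, div_eq_mul_inv, ← Real.rpow_neg hq.le]
      ring
    · apply IntervalIntegrable.add
      · exact (wInt l hl _ (by fun_prop)).const_mul _
      · exact (wInt l hl _ (by fun_prop)).const_mul _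
    · exact (wInt l hl _ (by fun_prop)).const_mul _
    · exact (wInt l hl _ (by fun_prop)).const_mul _
  unfold DxBesselPoissonKernel
  rw [Real.mul_rpow hx.le hy.le]
  have hyl : y ^ l = y ^ (l - 1) * y := by
    rw [← Real.rpow_add_one hy.ne']; congr 1; ring
  rw [hyl]
  linear_combination (-(2 * l / π) * x ^ l * t * y ^ (l - 1)) * e1

noncomputable def S0 (l : ℝ) : ℝ := ∫ θ in (0:ℝ)..π, Real.sin θ ^ (2 * l - 1)

theorem w_nonneg (l θ : ℝ) (hθ : θ ∈ Icc 0 π) : 0 ≤ Real.sin θ ^ (2 * l - 1) :=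
  Real.rpow_nonneg (Real.sin_nonneg_of_nonneg_of_le_pi hθ.1 hθ.2) _

theorem S0_nonneg (l : ℝ) : 0 ≤ S0 l :=
  intervalIntegral.integral_nonneg Real.pi_pos.le fun θ hθ => w_nonneg l θ hθ

theorem A_le_B (l x t y : ℝ) (hl : 0 < l) (hx : 0 < x) (ht : 0 < t) (hy : 0 < y) :
    |Afun l x t y| ≤ Bfun l x t y := by
  unfold Afun Bfun
  rw [← Real.norm_eq_abs]
  refine intervalIntegral.norm_integral_le_of_norm_le Real.pi_pos.le ?_
    (wInt l hl _ (Qcont x y t _ hx.le hy.le ht))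
  refine Filter.Eventually.of_forall fun θ hθ => ?_
  have hw := w_nonneg l θ (Ioc_subset_Icc_self hθ)
  have hq := Qpos x y t θ hx.le hy.le ht
  rw [norm_mul, norm_mul, Real.norm_of_nonneg hw,
    Real.norm_of_nonneg (Real.rpow_nonneg hq.le (-(l + 1)))]
  have h1 : ‖Real.cos θ‖ ≤ 1 := Real.abs_cos_le_one θ
  have h2 := Real.rpow_nonneg hq.le (-(l + 1))
  exact mul_le_mul_of_nonneg_left (mul_le_of_le_one_left h2 h1) hw

theorem B_bound1 (l x t y : ℝ) (hl : 0 < l) (hx : 0 < x) (ht : 0 < t) (hy : 0 < y) :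
    Bfun l x t y ≤ S0 l * ((x - y) ^ 2 + t ^ 2) ^ (-(l + 1)) := by
  unfold Bfun S0
  rw [← intervalIntegral.integral_mul_const]
  refine intervalIntegral.integral_mono_on Real.pi_pos.le
    (wInt l hl _ (Qcont x y t _ hx.le hy.le ht)) (wInt l hl _ continuous_const) ?_
  intro θ hθ
  refine mul_le_mul_of_nonneg_left ?_ (w_nonneg l θ hθ)
  exact Real.rpow_le_rpow_of_nonpos (by positivity) (Qge x y t θ hx.le hy.le) (by linarith)

theorem aux_int (l D E : ℝ) (hl : 0 < l) (hD : 0 < D) (hE : 0 < E) :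
    IntervalIntegrable (fun θ => Real.sin θ * (1 - Real.cos θ) ^ (l - 1) *
      (D + E * (1 - Real.cos θ)) ^ (-(l + 1))) volume 0 π ∧
    ∫ θ in (0:ℝ)..π, Real.sin θ * (1 - Real.cos θ) ^ (l - 1) *
      (D + E * (1 - Real.cos θ)) ^ (-(l + 1)) ≤ E ^ (-l) / (l * D) := by
  have hp : ∀ θ, 0 < D + E * (1 - Real.cos θ) := fun θ => by
    have := Real.cos_le_one θ
    have := mul_nonneg hE.le (sub_nonneg.2 this)
    linarith
  have hcont : ContinuousOn (fun θ => (1 / (l * D)) * ((1 - Real.cos θ) ^ l *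
      (D + E * (1 - Real.cos θ)) ^ (-l))) (Icc 0 π) := by
    apply Continuous.continuousOn
    apply continuous_const.mul
    apply Continuous.mul
    · exact Continuous.rpow_const (by fun_prop) (fun _ => Or.inr hl.le)
    · exact Continuous.rpow_const (by fun_prop) (fun θ => Or.inl (hp θ).ne')
  have hderiv : ∀ θ ∈ Ioo 0 π, HasDerivAt (fun θ => (1 / (l * D)) * ((1 - Real.cos θ) ^ l *
      (D + E * (1 - Real.cos θ)) ^ (-l))) (Real.sin θ * (1 - Real.cos θ) ^ (l - 1) *
      (D + E * (1 - Real.cos θ)) ^ (-(l + 1))) θ := by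
    intro θ hθ
    have hc : 0 < 1 - Real.cos θ := by
      have := Real.cos_lt_cos_of_nonneg_of_le_pi le_rfl hθ.2.le hθ.1
      rw [Real.cos_zero] at this
      linarith
    have h1 : HasDerivAt (fun θ => 1 - Real.cos θ) (Real.sin θ) θ := by
      simpa using (Real.hasDerivAt_cos θ).const_sub 1
    have h2 := (h1.const_mul E).const_add D
    have h3 := ((h1.rpow_const (p := l) (Or.inl hc.ne')).mul
      (h2.rpow_const (p := -l) (Or.inl (hp θ).ne'))).const_mul (1 / (l * D))
    refine h3.congr_deriv ?_
    have e1 : (1 - Real.cos θ) ^ l = (1 - Real.cos θ) ^ (l - 1) * (1 - Real.cos θ) := by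
      rw [← Real.rpow_add_one hc.ne']; congr 1; ring
    have e2 : (D + E * (1 - Real.cos θ)) ^ (-l) =
        (D + E * (1 - Real.cos θ)) ^ (-(l + 1)) * (D + E * (1 - Real.cos θ)) := by
      rw [← Real.rpow_add_one (hp θ).ne']; congr 1; ring
    rw [e1, e2, show -l - 1 = -(l + 1) by ring]
    field_simp
    ring
  have hnn : ∀ θ ∈ Ioo 0 π, 0 ≤ Real.sin θ * (1 - Real.cos θ) ^ (l - 1) *
      (D + E * (1 - Real.cos θ)) ^ (-(l + 1)) := by
    intro θ hθ
    have := Real.sin_pos_of_pos_of_lt_pi hθ.1 hθ.2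
    have hc : 0 ≤ 1 - Real.cos θ := by linarith [Real.cos_le_one θ]
    have := hp θ
    positivity
  have hint : IntervalIntegrable (fun θ => Real.sin θ * (1 - Real.cos θ) ^ (l - 1) *
      (D + E * (1 - Real.cos θ)) ^ (-(l + 1))) volume 0 π := by
    rw [intervalIntegrable_iff, uIoc_of_le Real.pi_pos.le]
    exact intervalIntegral.integrableOn_deriv_of_nonneg hcont hderiv hnn
  refine ⟨hint, ?_⟩
  rw [intervalIntegral.integral_eq_sub_of_hasDerivAt_of_le Real.pi_pos.le hcont hderiv hint]
  simp only [Real.cos_pi, Real.cos_zero, sub_self, Real.zero_rpow hl.ne', zero_mul, mul_zero,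
    sub_zero]
  have h2 : (0:ℝ) < 1 - -1 := by norm_num
  have h3 : (D + E * (1 - -1)) ^ (-l) ≤ (E * (1 - -1)) ^ (-l) :=
    Real.rpow_le_rpow_of_nonpos (by positivity) (by linarith) (by linarith)
  rw [Real.mul_rpow hE.le h2.le] at h3
  have h4 : ((1:ℝ) - -1) ^ l * (1 - -1) ^ (-l) = 1 := by
    rw [← Real.rpow_add h2]; simp
  calc 1 / (l * D) * ((1 - -1) ^ l * (D + E * (1 - -1)) ^ (-l))
      ≤ 1 / (l * D) * ((1 - -1) ^ l * (E ^ (-l) * (1 - -1) ^ (-l))) := by gcongr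
    _ = 1 / (l * D) * (E ^ (-l) * (((1:ℝ) - -1) ^ l * (1 - -1) ^ (-l))) := by ring
    _ = _ := by rw [h4]; ring

theorem B_bound2 (l x t y : ℝ) (hl : 0 < l) (hx : 0 < x) (ht : 0 < t) (hy : 0 < y) :
    Bfun l x t y ≤ (2 ^ l / l + S0 l) * ((2 * x * y) ^ (-l) / ((x - y) ^ 2 + t ^ 2)) := by
  have hD : 0 < (x - y) ^ 2 + t ^ 2 := by positivity
  have hE : 0 < 2 * x * y := by positivity
  set D := (x - y) ^ 2 + t ^ 2 with hDdef
  set E := 2 * x * y with hEdef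
  obtain ⟨i1, i2⟩ := aux_int l D E hl hD hE
  have i3 := (wInt l hl (fun _ => E ^ (-l) / D) continuous_const)
  have i4 := wInt l hl _ (Qcont x y t (-(l + 1)) hx.le hy.le ht)
  have : Bfun l x t y ≤ ∫ θ in (0:ℝ)..π, (2 ^ l * (Real.sin θ * (1 - Real.cos θ) ^ (l - 1) *
      (D + E * (1 - Real.cos θ)) ^ (-(l + 1))) + Real.sin θ ^ (2 * l - 1) * (E ^ (-l) / D)) := by
    unfold Bfun
    refine intervalIntegral.integral_mono_on_of_le_Ioo Real.pi_pos.le i4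
      ((i1.const_mul _).add i3) ?_
    intro θ hθ
    have hs := Real.sin_pos_of_pos_of_lt_pi hθ.1 hθ.2
    have hc : 0 < 1 - Real.cos θ := by
      have := Real.cos_lt_cos_of_nonneg_of_le_pi le_rfl hθ.2.le hθ.1
      rw [Real.cos_zero] at this
      linarith
    have hw : 0 < Real.sin θ ^ (2 * l - 1) := by positivity
    have hq : 0 < D + E * (1 - Real.cos θ) := by positivity
    rw [← hDdef, ← hEdef]
    rcases le_or_gt 0 (Real.cos θ) with h | h
    · have h1 : Real.sin θ ^ (2 * l - 1) ≤ 2 ^ l * (Real.sin θ * (1 - Real.cos θ) ^ (l - 1)) := by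
        have hc1 : 0 < 1 + Real.cos θ := by linarith
        have e : Real.sin θ ^ (2 * l - 1) = (1 + Real.cos θ) ^ (l - 1) *
            (Real.sin θ * (1 - Real.cos θ) ^ (l - 1)) := by
          have e1 : (1 + Real.cos θ) * (1 - Real.cos θ) = Real.sin θ ^ (2:ℝ) := by
            rw [Real.rpow_two]
            nlinarith [Real.sin_sq_add_cos_sq θ]
          rw [mul_left_comm, ← Real.mul_rpow hc1.le hc.le, e1, ← Real.rpow_mul hs.le,
            mul_comm (Real.sin θ), ← Real.rpow_add_one hs.ne']
          congr 1
          ring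
        rw [e]
        refine mul_le_mul_of_nonneg_right ?_ (by positivity)
        have hle2 : 1 + Real.cos θ ≤ 2 := by linarith [Real.cos_le_one θ]
        rcases le_or_gt 1 l with h' | h'
        · calc (1 + Real.cos θ) ^ (l - 1) ≤ 2 ^ (l - 1) :=
                Real.rpow_le_rpow hc1.le hle2 (by linarith)
            _ ≤ 2 ^ l := Real.rpow_le_rpow_of_exponent_le (by norm_num) (by linarith)
        · calc (1 + Real.cos θ) ^ (l - 1) ≤ 1 :=
                Real.rpow_le_one_of_one_le_of_nonpos (by linarith) (by linarith)
            _ ≤ 2 ^ l := Real.one_le_rpow (by norm_num) hl.le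
      have h2 : 0 ≤ Real.sin θ ^ (2 * l - 1) * (E ^ (-l) / D) := by positivity
      calc _ ≤ 2 ^ l * (Real.sin θ * (1 - Real.cos θ) ^ (l - 1)) *
            (D + E * (1 - Real.cos θ)) ^ (-(l + 1)) := by gcongr
        _ ≤ _ := by linarith
    · have h2 : 0 ≤ 2 ^ l * (Real.sin θ * (1 - Real.cos θ) ^ (l - 1) *
          (D + E * (1 - Real.cos θ)) ^ (-(l + 1))) := by positivity
      have h3 : (D + E * (1 - Real.cos θ)) ^ (-(l + 1)) ≤ E ^ (-l) / D := by
        have e : (D + E * (1 - Real.cos θ)) ^ (-(l + 1)) =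
            (D + E * (1 - Real.cos θ)) ^ (-l) / (D + E * (1 - Real.cos θ)) := by
          rw [← Real.rpow_sub_one hq.ne']; congr 1; ring
        rw [e]
        have : E ≤ E * (1 - Real.cos θ) := le_mul_of_one_le_right hE.le (by linarith)
        apply div_le_div₀ (by positivity) _ hD (by linarith)
        exact Real.rpow_le_rpow_of_nonpos hE (by linarith) (by linarith)
      have := mul_le_mul_of_nonneg_left h3 hw.le
      linarith
  refine this.trans ?_
  rw [intervalIntegral.integral_add (i1.const_mul _) i3, intervalIntegral.integral_const_mul,
    intervalIntegral.integral_mul_const]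
  have := mul_le_mul_of_nonneg_left i2 (show (0:ℝ) ≤ 2 ^ l by positivity)
  calc _ ≤ 2 ^ l * (E ^ (-l) / (l * D)) + S0 l * (E ^ (-l) / D) := by
        unfold S0; linarith
    _ = _ := by field_simp

/-- the majorant -/
noncomputable def Mfun (l x t y : ℝ) : ℝ :=
  √(x ^ 2 + t ^ 2) * (y ^ (l - 1) * (x ^ 2 + t ^ 2 + y ^ 2) ^ (-(l / 2) - 1)) +
    1 / √(x ^ 2 + t ^ 2) * (t / ((x - y) ^ 2 + t ^ 2))

noncomputable def C1 (l : ℝ) : ℝ := S0 l * 6 ^ (l + 1) + 4 * (2 ^ l / l + S0 l)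

theorem C1_pos (l : ℝ) (hl : 0 < l) : 0 < C1 l := by
  have := S0_nonneg l
  unfold C1
  positivity

theorem B_major (l x t y : ℝ) (hl : 0 < l) (hx : 0 < x) (ht : 0 < t) (hy : 0 < y) :
    x ^ l * t * (y ^ (l - 1) * Bfun l x t y) ≤ C1 l * Mfun l x t y := by
  have hS0 := S0_nonneg l
  have hD : 0 < (x - y) ^ 2 + t ^ 2 := by positivity
  have hr : 0 < √(x ^ 2 + t ^ 2) := by positivity
  have hrsq : √(x ^ 2 + t ^ 2) ^ 2 = x ^ 2 + t ^ 2 := Real.sq_sqrt (by positivity)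
  have hS : 0 < x ^ 2 + t ^ 2 + y ^ 2 := by positivity
  have b1 := B_bound1 l x t y hl hx ht hy
  have b2 := B_bound2 l x t y hl hx ht hy
  unfold C1 Mfun
  set r := √(x ^ 2 + t ^ 2) with hrdef
  have hxr : x ≤ r := Real.le_sqrt_of_sq_le (by nlinarith)
  have htr : t ≤ r := Real.le_sqrt_of_sq_le (by nlinarith)
  have n1 : 0 ≤ r * (y ^ (l - 1) * (x ^ 2 + t ^ 2 + y ^ 2) ^ (-(l / 2) - 1)) := by positivity
  have n2 : 0 ≤ 1 / r * (t / ((x - y) ^ 2 + t ^ 2)) := by positivity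
  have n3 : 0 ≤ S0 l * 6 ^ (l + 1) := by positivity
  have n4 : 0 ≤ (2 ^ l / l + S0 l) := by positivity
  by_cases hcase : t < x ∧ x < 2 * y ∧ y < 2 * x
  · obtain ⟨c1, c2, c3⟩ := hcase
    have key : x ^ l * t * (y ^ (l - 1) * ((2 * x * y) ^ (-l) / ((x - y) ^ 2 + t ^ 2))) ≤
        4 * (1 / r * (t / ((x - y) ^ 2 + t ^ 2))) := by
      have e : x ^ l * t * (y ^ (l - 1) * ((2 * x * y) ^ (-l) / ((x - y) ^ 2 + t ^ 2))) =
          2 ^ (-l) * (1 / y) * (t / ((x - y) ^ 2 + t ^ 2)) := by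
        rw [Real.mul_rpow (by positivity) hy.le, Real.mul_rpow (by positivity) hx.le,
          Real.rpow_neg hx.le, Real.rpow_neg hy.le, Real.rpow_sub_one hy.ne']
        have := Real.rpow_pos_of_pos hx l
        have := Real.rpow_pos_of_pos hy l
        field_simp
      rw [e]
      have h1 : (2:ℝ) ^ (-l) ≤ 1 :=
        Real.rpow_le_one_of_one_le_of_nonpos (by norm_num) (by linarith)
      have h2 : 1 / y ≤ 4 * (1 / r) := by
        have : r ≤ 4 * y := by
          apply Real.sqrt_le_iff.2
          constructor
          · positivity
          · nlinarith
        rw [mul_one_div, div_le_div_iff₀ hy hr]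
        linarith
      calc _ ≤ 1 * (4 * (1 / r)) * (t / ((x - y) ^ 2 + t ^ 2)) := by gcongr
        _ = _ := by ring
    calc _ ≤ x ^ l * t * (y ^ (l - 1) *
          ((2 ^ l / l + S0 l) * ((2 * x * y) ^ (-l) / ((x - y) ^ 2 + t ^ 2)))) := by gcongr
      _ = (2 ^ l / l + S0 l) * (x ^ l * t * (y ^ (l - 1) *
          ((2 * x * y) ^ (-l) / ((x - y) ^ 2 + t ^ 2)))) := by ring
      _ ≤ (2 ^ l / l + S0 l) * (4 * (1 / r * (t / ((x - y) ^ 2 + t ^ 2)))) := by gcongr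
      _ ≤ _ := by
        have := mul_nonneg n3 n1
        have := mul_nonneg n3 n2
        have := mul_nonneg n4 n1
        nlinarith
  · have hDS : (x ^ 2 + t ^ 2 + y ^ 2) / 6 ≤ (x - y) ^ 2 + t ^ 2 := by
      by_cases c1 : t < x
      · by_cases c2 : x < 2 * y
        · have c3 : 2 * x ≤ y := by
            by_contra h
            exact hcase ⟨c1, c2, not_le.1 h⟩
          nlinarith
        · nlinarith
      · push Not at c1
        nlinarith [sq_nonneg (6 * y - 5 * x), sq_nonneg (5 * y - 6 * x), mul_self_le_mul_self hx.le c1]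
    have key : x ^ l * t * (y ^ (l - 1) * ((x - y) ^ 2 + t ^ 2) ^ (-(l + 1))) ≤
        6 ^ (l + 1) * (r * (y ^ (l - 1) * (x ^ 2 + t ^ 2 + y ^ 2) ^ (-(l / 2) - 1))) := by
      have h1 : ((x - y) ^ 2 + t ^ 2) ^ (-(l + 1)) ≤
          6 ^ (l + 1) * ((x ^ 2 + t ^ 2 + y ^ 2) ^ (-(l / 2)) *
            (x ^ 2 + t ^ 2 + y ^ 2) ^ (-(l / 2) - 1)) := by
        calc _ ≤ ((x ^ 2 + t ^ 2 + y ^ 2) / 6) ^ (-(l + 1)) :=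
              Real.rpow_le_rpow_of_nonpos (by positivity) hDS (by linarith)
          _ = _ := by
            rw [← Real.rpow_add hS, Real.div_rpow hS.le (by norm_num),
              Real.rpow_neg (by norm_num : (0:ℝ) ≤ 6), div_inv_eq_mul, mul_comm]
            congr 2
            ring
      have h2 : x ^ l * (x ^ 2 + t ^ 2 + y ^ 2) ^ (-(l / 2)) ≤ 1 := by
        have : x ^ l = (x ^ 2) ^ (l / 2) := by
          rw [← Real.rpow_natCast, ← Real.rpow_mul hx.le]; congr 1; push_cast; ring
        rw [this, Real.rpow_neg hS.le, ← div_eq_mul_inv, div_le_one (by positivity)]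
        exact Real.rpow_le_rpow (by positivity) (by nlinarith) (by positivity)
      calc _ ≤ x ^ l * t * (y ^ (l - 1) * (6 ^ (l + 1) * ((x ^ 2 + t ^ 2 + y ^ 2) ^ (-(l / 2)) *
            (x ^ 2 + t ^ 2 + y ^ 2) ^ (-(l / 2) - 1)))) := by gcongr
        _ = 6 ^ (l + 1) * (x ^ l * (x ^ 2 + t ^ 2 + y ^ 2) ^ (-(l / 2))) * (t *
            (y ^ (l - 1) * (x ^ 2 + t ^ 2 + y ^ 2) ^ (-(l / 2) - 1))) := by ring
        _ ≤ 6 ^ (l + 1) * 1 * (r *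
            (y ^ (l - 1) * (x ^ 2 + t ^ 2 + y ^ 2) ^ (-(l / 2) - 1))) := by gcongr
        _ = _ := by ring
    calc _ ≤ x ^ l * t * (y ^ (l - 1) * (S0 l * ((x - y) ^ 2 + t ^ 2) ^ (-(l + 1)))) := by gcongr
      _ = S0 l * (x ^ l * t * (y ^ (l - 1) * ((x - y) ^ 2 + t ^ 2) ^ (-(l + 1)))) := by ring
      _ ≤ S0 l * (6 ^ (l + 1) *
          (r * (y ^ (l - 1) * (x ^ 2 + t ^ 2 + y ^ 2) ^ (-(l / 2) - 1)))) := by gcongr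
      _ ≤ _ := by
        have := mul_nonneg n3 n2
        have := mul_nonneg n4 n1
        have := mul_nonneg n4 n2
        nlinarith

theorem M1_int (l R : ℝ) (hl : 0 < l) (hR : 0 < R) :
    IntegrableOn (fun y => y ^ (l - 1) * (R + y ^ 2) ^ (-(l / 2) - 1)) (Ioi 0) ∧
    ∫ y in Ioi (0:ℝ), y ^ (l - 1) * (R + y ^ 2) ^ (-(l / 2) - 1) = 1 / (l * R) := by
  have hp : ∀ y : ℝ, 0 < R + y ^ 2 := fun y => by positivity
  have hcont : ContinuousWithinAt (fun y : ℝ => 1 / (l * R) * (y ^ l * (R + y ^ 2) ^ (-(l / 2))))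
      (Ici 0) 0 := by
    apply Continuous.continuousWithinAt
    apply continuous_const.mul
    apply Continuous.mul
    · exact Continuous.rpow_const (by fun_prop) (fun _ => Or.inr hl.le)
    · exact Continuous.rpow_const (by fun_prop) (fun y => Or.inl (hp y).ne')
  have hderiv : ∀ y ∈ Ioi (0:ℝ),
      HasDerivAt (fun y : ℝ => 1 / (l * R) * (y ^ l * (R + y ^ 2) ^ (-(l / 2))))
      (y ^ (l - 1) * (R + y ^ 2) ^ (-(l / 2) - 1)) y := by
    intro y hy
    have hy : 0 < y := hy
    have h1 : HasDerivAt (fun y : ℝ => R + y ^ 2) (2 * y) y := by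
      simpa using ((hasDerivAt_id y).pow 2).const_add R
    have h3 := (((hasDerivAt_id y).rpow_const (p := l) (Or.inl hy.ne')).mul
      (h1.rpow_const (p := -(l / 2)) (Or.inl (hp y).ne'))).const_mul (1 / (l * R))
    refine h3.congr_deriv ?_
    simp only [id]
    have e1 : y ^ l = y ^ (l - 1) * y := by
      rw [← Real.rpow_add_one hy.ne']; congr 1; ring
    have e2 : (R + y ^ 2) ^ (-(l / 2)) = (R + y ^ 2) ^ (-(l / 2) - 1) * (R + y ^ 2) := by
      rw [← Real.rpow_add_one (hp y).ne']; congr 1; ring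
    rw [e1, e2]
    field_simp
    ring
  have hnn : ∀ y ∈ Ioi (0:ℝ), 0 ≤ y ^ (l - 1) * (R + y ^ 2) ^ (-(l / 2) - 1) := by
    intro y hy
    have hy : 0 < y := hy
    positivity
  have hlim : Filter.Tendsto (fun y : ℝ => 1 / (l * R) * (y ^ l * (R + y ^ 2) ^ (-(l / 2))))
      Filter.atTop (nhds (1 / (l * R))) := by
    have h0 : Filter.Tendsto (fun y : ℝ => R + y ^ 2) Filter.atTop Filter.atTop :=
      Filter.tendsto_atTop_add_const_left _ _ (Filter.tendsto_pow_atTop (by norm_num))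
    have h1 : Filter.Tendsto (fun y : ℝ => 1 - R / (R + y ^ 2)) Filter.atTop (nhds (1 - 0)) :=
      tendsto_const_nhds.sub (h0.const_div_atTop R)
    have h2 := (h1.rpow_const (p := l / 2) (Or.inl (by norm_num))).const_mul (1 / (l * R))
    simp only [sub_zero, Real.one_rpow, mul_one] at h2
    refine h2.congr' ?_
    filter_upwards [Filter.eventually_gt_atTop 0] with y hy
    congr 1
    rw [show 1 - R / (R + y ^ 2) = y ^ 2 / (R + y ^ 2) by field_simp [(hp y).ne']; ring,
      Real.div_rpow (by positivity) (hp y).le, Real.rpow_neg (hp y).le, div_eq_mul_inv]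
    congr 1
    rw [← Real.rpow_natCast, ← Real.rpow_mul hy.le]; congr 1; push_cast; ring
  refine ⟨integrableOn_Ioi_deriv_of_nonneg hcont hderiv hnn hlim, ?_⟩
  rw [integral_Ioi_of_hasDerivAt_of_nonneg hcont hderiv hnn hlim]
  simp [Real.zero_rpow hl.ne']

theorem pois_deriv (x t y : ℝ) (ht : 0 < t) :
    HasDerivAt (fun y : ℝ => Real.arctan ((y - x) / t)) (t / ((x - y) ^ 2 + t ^ 2)) y := by
  have h1 := (((hasDerivAt_id y).sub_const x).div_const t).arctan
  refine h1.congr_deriv ?_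
  have : 0 < (x - y) ^ 2 + t ^ 2 := by positivity
  simp only [id]
  field_simp
  ring

theorem M2_int (x t : ℝ) (ht : 0 < t) :
    IntegrableOn (fun y => t / ((x - y) ^ 2 + t ^ 2)) (Ioi 0) ∧
    ∫ y in Ioi (0:ℝ), t / ((x - y) ^ 2 + t ^ 2) ≤ π := by
  have hd := fun y (_ : y ∈ Ici (0:ℝ)) => pois_deriv x t y ht
  have hnn : ∀ y ∈ Ioi (0:ℝ), 0 ≤ t / ((x - y) ^ 2 + t ^ 2) := fun y _ => by positivity
  have hlim : Filter.Tendsto (fun y : ℝ => Real.arctan ((y - x) / t)) Filter.atTop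
      (nhds (π / 2)) := by
    have h1 : Filter.Tendsto (fun y : ℝ => (y - x) / t) Filter.atTop Filter.atTop :=
      (Filter.tendsto_atTop_add_const_right _ (-x) Filter.tendsto_id).atTop_div_const ht
    exact (Real.tendsto_arctan_atTop.mono_right nhdsWithin_le_nhds).comp h1
  refine ⟨integrableOn_Ioi_deriv_of_nonneg' hd hnn hlim, ?_⟩
  rw [integral_Ioi_of_hasDerivAt_of_nonneg' hd hnn hlim]
  linarith [Real.neg_pi_div_two_lt_arctan ((0 - x) / t)]

theorem M_int (l x t : ℝ) (hl : 0 < l) (hx : 0 < x) (ht : 0 < t) :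
    IntegrableOn (Mfun l x t) (Ioi 0) ∧
    ∫ y in Ioi (0:ℝ), Mfun l x t y ≤ (1 / l + π) / √(x ^ 2 + t ^ 2) := by
  have hR : 0 < x ^ 2 + t ^ 2 := by positivity
  obtain ⟨a1, a2⟩ := M1_int l (x ^ 2 + t ^ 2) hl hR
  obtain ⟨b1, b2⟩ := M2_int x t ht
  have c1 := a1.const_mul (√(x ^ 2 + t ^ 2))
  have c2 := b1.const_mul (1 / √(x ^ 2 + t ^ 2))
  refine ⟨c1.add c2, ?_⟩
  unfold Mfun
  rw [integral_add c1 c2, integral_const_mul, integral_const_mul, a2]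
  have hr : 0 < √(x ^ 2 + t ^ 2) := by positivity
  have hrsq : √(x ^ 2 + t ^ 2) ^ 2 = x ^ 2 + t ^ 2 := Real.sq_sqrt (by positivity)
  rw [← hrsq, Real.sqrt_sq hr.le]
  set r := √(x ^ 2 + t ^ 2)
  calc _ ≤ r * (1 / (l * r ^ 2)) + 1 / r * π := by gcongr
    _ = _ := by field_simp

theorem main_bound (l x t : ℝ) (hl : 0 < l) (hx : 0 < x) (ht : 0 < t) :
    |∫ y in Ioi (0:ℝ), DxBesselPoissonKernel l x y t| ≤
      (2 * l / π * (l * (C1 l * (1 / l + π)))) / √(x ^ 2 + t ^ 2) := by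
  have hC1 := C1_pos l hl
  have hS0 := S0_nonneg l
  have hr : 0 < √(x ^ 2 + t ^ 2) := by positivity
  have hxl : 0 < x ^ l * t := by positivity
  obtain ⟨m1, m2⟩ := M_int l x t hl hx ht
  have e : ∫ y in Ioi (0:ℝ), DxBesselPoissonKernel l x y t =
      -(2 * l / π) * x ^ l * t * ∫ y in Ioi (0:ℝ),
      ((l * y ^ (l - 1) * Afun l x t y + y ^ l * Afun' l x t y)
        + l * (y ^ (l - 1) * Afun l x t y)) := by
    rw [← integral_const_mul]
    apply setIntegral_congr_fun measurableSet_Ioi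
    intro y hy
    exact key_identity l x t y hl hx ht hy
  -- integrability of `y^(l-1) A`
  have gbound : ∀ y ∈ Ioi (0:ℝ), ‖x ^ l * t * (y ^ (l - 1) * Afun l x t y)‖ ≤
      C1 l * Mfun l x t y := by
    intro y hy
    have hy : 0 < y := hy
    refine le_trans ?_ (B_major l x t y hl hx ht hy)
    rw [norm_mul, Real.norm_of_nonneg hxl.le, norm_mul,
      Real.norm_of_nonneg (by positivity : 0 ≤ y ^ (l - 1)), Real.norm_eq_abs]
    have := A_le_B l x t y hl hx ht hy
    gcongr
  have gcont : ContinuousOn (fun y => x ^ l * t * (y ^ (l - 1) * Afun l x t y)) (Ioi 0) := by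
    apply continuousOn_const.mul
    apply ContinuousOn.mul
    · exact continuousOn_id.rpow_const (fun y hy => Or.inl (ne_of_gt hy))
    · intro y hy
      exact (A_deriv l x t y hl hx ht hy).continuousAt.continuousWithinAt
  have gint : IntegrableOn (fun y => x ^ l * t * (y ^ (l - 1) * Afun l x t y)) (Ioi 0) := by
    refine Integrable.mono' (m1.const_mul (C1 l))
      (gcont.aestronglyMeasurable measurableSet_Ioi) ?_
    exact (ae_restrict_iff' measurableSet_Ioi).2 (Filter.Eventually.of_forall gbound)
  have gint' : IntegrableOn (fun y => l * (y ^ (l - 1) * Afun l x t y)) (Ioi 0) := by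
    have := gint.const_mul (l * (x ^ l * t)⁻¹)
    refine this.congr (Filter.Eventually.of_forall fun y => ?_)
    simp only
    field_simp
  have gle : |x ^ l * t * ∫ y in Ioi (0:ℝ), y ^ (l - 1) * Afun l x t y| ≤
      C1 l * ((1 / l + π) / √(x ^ 2 + t ^ 2)) := by
    rw [← integral_const_mul, ← Real.norm_eq_abs]
    refine (norm_integral_le_of_norm_le (m1.const_mul (C1 l))
      ((ae_restrict_iff' measurableSet_Ioi).2 (Filter.Eventually.of_forall gbound))).trans ?_
    rw [integral_const_mul]
    gcongr
  have fin : |-(2 * l / π) * x ^ l * t * (l * ∫ y in Ioi (0:ℝ), y ^ (l - 1) * Afun l x t y)| ≤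
      (2 * l / π * (l * (C1 l * (1 / l + π)))) / √(x ^ 2 + t ^ 2) := by
    rw [show -(2 * l / π) * x ^ l * t * (l * ∫ y in Ioi (0:ℝ), y ^ (l - 1) * Afun l x t y) =
      -(2 * l / π * l) * (x ^ l * t * ∫ y in Ioi (0:ℝ), y ^ (l - 1) * Afun l x t y) by ring,
      abs_mul, abs_neg, abs_of_nonneg (by positivity : 0 ≤ 2 * l / π * l)]
    calc _ ≤ 2 * l / π * l * (C1 l * ((1 / l + π) / √(x ^ 2 + t ^ 2))) := by gcongr
      _ = _ := by ring
  rw [e]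
  by_cases hf : IntegrableOn (fun y => l * y ^ (l - 1) * Afun l x t y + y ^ l * Afun' l x t y)
      (Ioi 0)
  · have hzero : ∫ y in Ioi (0:ℝ), (l * y ^ (l - 1) * Afun l x t y + y ^ l * Afun' l x t y) = 0 := by
      have hb : ∀ y, 0 < y → |y ^ l * Afun l x t y| ≤
          y ^ l * (S0 l * ((x - y) ^ 2 + t ^ 2) ^ (-(l + 1))) := by
        intro y hy
        rw [abs_mul, abs_of_pos (by positivity : 0 < y ^ l)]
        have := (A_le_B l x t y hl hx ht hy).trans (B_bound1 l x t y hl hx ht hy)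
        gcongr
      rw [integral_Ioi_of_hasDerivAt_of_tendsto (f := fun y => y ^ l * Afun l x t y) (m := 0)
        ?_ ?_ hf ?_]
      · simp [Real.zero_rpow hl.ne']
      · have hb2 : ∀ y ∈ Ici (0:ℝ), ‖y ^ l * Afun l x t y‖ ≤
            y ^ l * (S0 l * (t ^ 2) ^ (-(l + 1))) := by
          intro y hy
          rcases eq_or_lt_of_le (show 0 ≤ y from hy) with h | h
          · rw [← h]; simp [Real.zero_rpow hl.ne']
          · refine (hb y h).trans ?_
            have : ((x - y) ^ 2 + t ^ 2) ^ (-(l + 1)) ≤ (t ^ 2) ^ (-(l + 1)) :=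
              Real.rpow_le_rpow_of_nonpos (by positivity) (by nlinarith [sq_nonneg (x - y)])
                (by linarith)
            gcongr
        unfold ContinuousWithinAt
        simp only [Real.zero_rpow hl.ne', zero_mul]
        refine squeeze_zero_norm' (Filter.eventually_of_mem self_mem_nhdsWithin hb2) ?_
        have hc : Continuous (fun y : ℝ => y ^ l * (S0 l * (t ^ 2) ^ (-(l + 1)))) :=
          (Continuous.rpow_const continuous_id (fun _ => Or.inr hl.le)).mul continuous_const
        have := hc.tendsto 0
        rw [Real.zero_rpow hl.ne', zero_mul] at this
        exact this.mono_left nhdsWithin_le_nhds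
      · intro y hy
        have hy : 0 < y := hy
        refine ((Real.hasDerivAt_rpow_const (p := l) (Or.inl hy.ne')).mul
          (A_deriv l x t y hl hx ht hy)).congr_deriv ?_
        ring
      · have hlim : Filter.Tendsto (fun y : ℝ => S0 l * 4 ^ (l + 1) * y ^ (-(l + 2)))
            Filter.atTop (nhds 0) := by
          have := (tendsto_rpow_neg_atTop (show 0 < l + 2 by linarith)).const_mul
            (S0 l * 4 ^ (l + 1))
          simpa using this
        refine squeeze_zero_norm' ?_ hlim
        filter_upwards [Filter.eventually_ge_atTop (2 * x)] with y hy
        have hy0 : 0 < y := by linarith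
        refine (hb y hy0).trans ?_
        have h1 : ((x - y) ^ 2 + t ^ 2) ^ (-(l + 1)) ≤ (y ^ 2 / 4) ^ (-(l + 1)) :=
          Real.rpow_le_rpow_of_nonpos (by positivity) (by nlinarith) (by linarith)
        have h2 : y ^ l * (y ^ 2 / 4) ^ (-(l + 1)) = 4 ^ (l + 1) * y ^ (-(l + 2)) := by
          rw [Real.div_rpow (by positivity) (by norm_num),
            Real.rpow_neg (by norm_num : (0:ℝ) ≤ 4), div_inv_eq_mul, ← Real.rpow_natCast,
            ← Real.rpow_mul hy0.le, ← mul_assoc, ← Real.rpow_add hy0, mul_comm]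
          congr 2
          push_cast
          ring
        calc _ ≤ y ^ l * (S0 l * (y ^ 2 / 4) ^ (-(l + 1))) := by gcongr
          _ = S0 l * (y ^ l * (y ^ 2 / 4) ^ (-(l + 1))) := by ring
          _ = _ := by rw [h2]; ring
    rw [integral_add hf gint', hzero, zero_add, integral_const_mul]
    exact fin
  · rw [integral_undef, mul_zero, abs_zero]
    · positivity
    · intro h
      apply hf
      refine (h.sub gint').congr (Filter.Eventually.of_forall fun y => ?_)
      simp

theorem pois_int (a b t : ℝ) (ht : 0 < t) :
    IntervalIntegrable (fun x : ℝ => t / (x ^ 2 + t ^ 2)) volume a b ∧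
    ∫ x in a..b, t / (x ^ 2 + t ^ 2) ≤ π := by
  have hi : IntervalIntegrable (fun x : ℝ => t / (x ^ 2 + t ^ 2)) volume a b := by
    apply Continuous.intervalIntegrable
    exact continuous_const.div (by fun_prop) (fun x => by positivity)
  refine ⟨hi, ?_⟩
  rw [intervalIntegral.integral_eq_sub_of_hasDerivAt (f := fun y => Real.arctan ((y - 0) / t))
    (fun x _ => (pois_deriv 0 t x ht).congr_deriv (by ring)) hi]
  linarith [Real.neg_pi_div_two_lt_arctan ((a - 0) / t), Real.arctan_lt_pi_div_two ((b - 0) / t)]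

/-- For every bounded interval `J = (a,b) ⊂ (0,∞)` with center `x_J` and length `|J|`,
`(x_J+|J|)²/|J|³ ∫₀^{|J|} ∫_J |t D_{λ,x}P_t^λ(1)(x)|² dx dt/t ≤ C`. -/
theorem statement3 (l : ℝ) (hl : 0 < l) :
    ∃ C > 0, ∀ a b : ℝ, 0 ≤ a → a < b →
      ((a + b) / 2 + (b - a)) ^ 2 / (b - a) ^ 3 *
        ∫ t in (0:ℝ)..(b - a), ∫ x in a..b,
          (t * ∫ y in Ioi (0:ℝ), DxBesselPoissonKernel l x y t) ^ 2 / t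
      ≤ C := by
  have hC1 := C1_pos l hl
  obtain ⟨K, hK, hF⟩ : ∃ K > 0, ∀ x t : ℝ, 0 < x → 0 < t →
      (t * ∫ y in Ioi (0:ℝ), DxBesselPoissonKernel l x y t) ^ 2 / t ≤
        K * (t / (x ^ 2 + t ^ 2)) := by
    refine ⟨(2 * l / π * (l * (C1 l * (1 / l + π)))) ^ 2, by positivity, ?_⟩
    intro x t hx ht
    have h := main_bound l x t hl hx ht
    have h2 := pow_le_pow_left₀ (abs_nonneg _) h 2
    rw [sq_abs, div_pow, Real.sq_sqrt (by positivity)] at h2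
    calc _ = t * (∫ y in Ioi (0:ℝ), DxBesselPoissonKernel l x y t) ^ 2 := by field_simp
      _ ≤ t * ((2 * l / π * (l * (C1 l * (1 / l + π)))) ^ 2 / (x ^ 2 + t ^ 2)) := by gcongr
      _ = _ := by ring
  refine ⟨K * 25 * π, by positivity, ?_⟩
  intro a b ha hab
  have hL : 0 < b - a := by linarith
  have hin : ∀ t, 0 < t → ‖∫ x in a..b,
          (t * ∫ y in Ioi (0:ℝ), DxBesselPoissonKernel l x y t) ^ 2 / t‖ ≤
          ∫ x in a..b, K * (t / (x ^ 2 + t ^ 2)) := by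
    intro t ht
    refine intervalIntegral.norm_integral_le_of_norm_le hab.le ?_ ((pois_int a b t ht).1.const_mul K)
    refine Filter.Eventually.of_forall fun x hx => ?_
    have hx0 : 0 < x := by linarith [hx.1]
    rw [Real.norm_of_nonneg (by positivity)]
    exact hF x t hx0 ht
  have fin : ∀ M, 0 ≤ M → (∀ t ∈ Ioc 0 (b - a), ∫ x in a..b, K * (t / (x ^ 2 + t ^ 2)) ≤ M) →
      ((a + b) / 2 + (b - a)) ^ 2 / (b - a) ^ 3 *
        ∫ t in (0:ℝ)..(b - a), ∫ x in a..b,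
          (t * ∫ y in Ioi (0:ℝ), DxBesselPoissonKernel l x y t) ^ 2 / t ≤
      ((a + b) / 2 + (b - a)) ^ 2 / (b - a) ^ 3 * (M * (b - a)) := by
    intro M hM h
    refine mul_le_mul_of_nonneg_left ?_ (by positivity)
    refine (le_abs_self _).trans ?_
    have := intervalIntegral.norm_integral_le_of_norm_le_const (a := 0) (b := b - a) (C := M)
      (f := fun t => ∫ x in a..b,
          (t * ∫ y in Ioi (0:ℝ), DxBesselPoissonKernel l x y t) ^ 2 / t) (by
        intro t ht
        rw [uIoc_of_le hL.le] at ht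
        exact (hin t ht.1).trans (h t ht))
    rwa [sub_zero, abs_of_pos hL] at this
  have hpi := Real.pi_gt_three
  rcases lt_or_ge a (b - a) with hc | hc
  · refine (fin (K * π) (by positivity) ?_).trans ?_
    · intro t ht
      rw [intervalIntegral.integral_const_mul]
      have := (pois_int a b t ht.1).2
      gcongr
    · calc _ ≤ (5 * (b - a)) ^ 2 / (b - a) ^ 3 * (K * π * (b - a)) := by
            gcongr <;> linarith
        _ = _ := by field_simp; ring
  · have ha0 : 0 < a := by linarith
    refine (fin (K * ((b - a) / a ^ 2) * (b - a)) (by positivity) ?_).trans ?_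
    · intro t ht
      have ht0 := ht.1
      refine (le_abs_self _).trans ?_
      have := intervalIntegral.norm_integral_le_of_norm_le_const (a := a) (b := b)
        (C := K * ((b - a) / a ^ 2)) (f := fun x => K * (t / (x ^ 2 + t ^ 2))) (by
        intro x hx
        rw [uIoc_of_le hab.le] at hx
        rw [Real.norm_of_nonneg (by positivity)]
        have h1 := ht.2
        have h2 : a ^ 2 ≤ x ^ 2 + t ^ 2 := by nlinarith [hx.1]
        gcongr)
      rwa [abs_of_pos hL] at this
    · calc _ ≤ (5 * a) ^ 2 / (b - a) ^ 3 * (K * ((b - a) / a ^ 2) * (b - a) * (b - a)) := by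
            gcongr <;> linarith
        _ = K * 25 * 1 := by field_simp; ring
        _ ≤ _ := by gcongr; linarith
end
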